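/- If ω ∈ D^{p,q} satisfies g^l ω = 0 and l + p + q < n + 1 + k, then c^k ω = 0. -/

import Mathlib

open scoped BigOperators

namespace DoubleForm

/-- The model Euclidean vector space of dimension `n` (with the standard inner product). -/
abbrev V (n : ℕ) := Fin n → ℝ

/-- The standard orthonormal basis of `V n`. -/
def E (n : ℕ) (j : Fin n) : V n := fun k => if k = j then 1 else 0

/-- Raw double forms of bidegree `(p,q)`: real valued functions of `p` vectors and `q` vectors.
Genuine double forms are singled out by `IsDF`. -/
abbrev DF (n p q : ℕ) := (Fin p → V n) → (Fin q → V n) → ℝ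

/-- `ω` is a genuine double form: multilinear and alternating in the first `p`
and in the last `q` arguments. -/
def IsDF {n p q : ℕ} (ω : DF n p q) : Prop :=
  ∃ F : AlternatingMap ℝ (V n) (AlternatingMap ℝ (V n) ℝ (Fin q)) (Fin p),
    ∀ x y, ω x y = F x y

/-- Transport of double forms along equalities of the degrees. -/
def DFcast {n p q p' q' : ℕ} (h1 : p = p') (h2 : q = q') (ω : DF n p q) : DF n p' q' :=
  fun x y => ω (fun i => x (Fin.cast h1 i)) (fun j => y (Fin.cast h2 j))

/-- The product of double forms (Kulkarni's product). -/
noncomputable def mul {n p q r s : ℕ} (ω : DF n p q) (η : DF n r s) :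
    DF n (p + r) (q + s) := fun x y =>
  (((p.factorial * r.factorial * q.factorial * s.factorial : ℕ) : ℝ))⁻¹ *
    ∑ σ : Equiv.Perm (Fin (p + r)), ∑ ρ : Equiv.Perm (Fin (q + s)),
      ((Equiv.Perm.sign σ : ℤ) : ℝ) * ((Equiv.Perm.sign ρ : ℤ) : ℝ) *
        ω (fun i => x (σ (Fin.castAdd r i))) (fun j => y (ρ (Fin.castAdd s j))) *
        η (fun i => x (σ (Fin.natAdd p i))) (fun j => y (ρ (Fin.natAdd q j)))

/-- The metric `g` as a double form of bidegree `(1,1)`. -/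
noncomputable def gm (n : ℕ) : DF n 1 1 := fun x y => ∑ j : Fin n, x 0 j * y 0 j

/-- Powers `g^l` of the metric in the algebra of double forms. -/
noncomputable def gpow (n : ℕ) : (l : ℕ) → DF n l l
  | 0 => fun _ _ => 1
  | l + 1 => mul (gpow n l) (gm n)

/-- The contraction map `c : D^{p,q} → D^{p-1,q-1}` (zero if `p = 0` or `q = 0`). -/
noncomputable def contr {n : ℕ} : ∀ {p q : ℕ}, DF n p q → DF n (p - 1) (q - 1)
  | p + 1, q + 1, ω => fun x y =>
      ∑ j : Fin n, ω (Fin.cons (E n j) x) (Fin.cons (E n j) y)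
  | 0, _, _ => 0
  | _ + 1, 0, _ => 0

/-- Iterated contraction `c^k`. -/
noncomputable def ck {n : ℕ} : ∀ (k : ℕ) {p q : ℕ}, DF n p q → DF n (p - k) (q - k)
  | 0, _, _, ω => ω
  | k + 1, _, _, ω => contr (ck k ω)

/-- The natural inner product on `D^{p,q}`. -/
noncomputable def innerDF {n p q : ℕ} (ω θ : DF n p q) : ℝ :=
  (((p.factorial * q.factorial : ℕ) : ℝ))⁻¹ *
    ∑ f : Fin p → Fin n, ∑ g : Fin q → Fin n,
      ω (fun i => E n (f i)) (fun j => E n (g j)) *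
        θ (fun i => E n (f i)) (fun j => E n (g j))

/-- The natural inner product extended to all bidegrees: distinct bidegrees are orthogonal. -/
noncomputable def innerDF2 {n p q r s : ℕ} (ω : DF n p q) (θ : DF n r s) : ℝ :=
  if h : p = r ∧ q = s then innerDF (DFcast h.1 h.2 ω) θ else 0

/-- Determinant of the `n × n` matrix whose first `p` rows are the basis vectors `E (f i)`
and whose remaining rows are the vectors `x`. -/
noncomputable def rowsDet {n : ℕ} (p : ℕ) (f : Fin p → Fin n) (x : Fin (n - p) → V n) : ℝ :=
  Matrix.det (Matrix.of fun i k : Fin n =>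
    if h : (i : ℕ) < p then E n (f ⟨(i : ℕ), h⟩) k
    else x ⟨(i : ℕ) - p, by have := i.isLt; omega⟩ k)

/-- The Hodge star operator extended to double forms, `D^{p,q} → D^{n-p,n-q}`. -/
noncomputable def hstar {n p q : ℕ} (ω : DF n p q) : DF n (n - p) (n - q) := fun x y =>
  (((p.factorial * q.factorial : ℕ) : ℝ))⁻¹ *
    ∑ f : Fin p → Fin n, ∑ g : Fin q → Fin n,
      ω (fun i => E n (f i)) (fun j => E n (g j)) * rowsDet p f x * rowsDet q g y

/-- The first Bianchi sum `B : D^{p,q} → D^{p+1,q-1}` (zero if `q = 0`). -/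
noncomputable def bianchi {n : ℕ} : ∀ {p q : ℕ}, DF n p q → DF n (p + 1) (q - 1)
  | p, q + 1, ω => fun x y =>
      ∑ j : Fin (p + 1), (-1 : ℝ) ^ ((j : ℕ) + 1) *
        ω (fun i => x (j.succAbove i)) (Fin.cons (x j) y)
  | _, 0, _ => 0

/-- Symmetric double forms of bidegree `(p,p)`. -/
def IsSymm {n p : ℕ} (ω : DF n p p) : Prop := ∀ x y, ω x y = ω y x

/-- The total (bigraded) space of double forms. -/
abbrev DT (n : ℕ) := ∀ p q : ℕ, DF n p q

/-- Embedding of the component `D^{p,q}` into the total space. -/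
noncomputable def emb {n : ℕ} (p q : ℕ) (ω : DF n p q) : DT n := fun p' q' =>
  if h : p = p' ∧ q = q' then DFcast h.1 h.2 ω else 0


/-- A function of `p` vectors which is multilinear and alternating. -/
def IsAlt {n p : ℕ} (f : (Fin p → V n) → ℝ) : Prop :=
  ∃ F : (V n) [⋀^Fin p]→ₗ[ℝ] ℝ, ∀ x, f x = F x

/-- Evaluation of alternating maps at a fixed family of vectors. -/
def evalAlt {M N : Type*} [AddCommGroup M] [Module ℝ M] [AddCommGroup N] [Module ℝ N] {p : ℕ}
    (x : Fin p → M) : (M [⋀^Fin p]→ₗ[ℝ] N) →ₗ[ℝ] N where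
  toFun F := F x
  map_add' _ _ := rfl
  map_smul' _ _ := rfl

theorem IsAlt.zero {n p : ℕ} : IsAlt (fun _ : Fin p → V n => (0 : ℝ)) :=
  ⟨0, fun _ => rfl⟩

theorem IsAlt.sum {n p : ℕ} {ι : Type*} (s : Finset ι) {f : ι → (Fin p → V n) → ℝ}
    (hf : ∀ i, IsAlt (f i)) : IsAlt (fun x => ∑ i ∈ s, f i x) := by
  choose F hF using hf
  exact ⟨∑ i ∈ s, F i, fun x =>
    (Finset.sum_congr rfl fun i _ => hF i x).trans (map_sum (evalAlt x) F s).symm⟩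

theorem IsAlt.const_mul {n p : ℕ} {f : (Fin p → V n) → ℝ} (hf : IsAlt f) (a : ℝ) :
    IsAlt (fun x => a * f x) := by
  obtain ⟨F, hF⟩ := hf
  exact ⟨a • F, fun x => by simp [hF]⟩

theorem IsAlt.cons {n p : ℕ} {f : (Fin (p + 1) → V n) → ℝ} (hf : IsAlt f) (v : V n) :
    IsAlt (fun x => f (Fin.cons v x)) := by
  obtain ⟨F, hF⟩ := hf
  exact ⟨F.curryLeft v, fun x => hF _⟩

/-- The exterior product of the covector `⟨·, v⟩` with an alternating map is alternating. -/
theorem IsAlt.wedge {n p : ℕ} {f : (Fin p → V n) → ℝ} (hf : IsAlt f) (v : V n) :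
    IsAlt (fun x : Fin (p + 1) → V n =>
      ∑ i : Fin (p + 1), (-1 : ℝ) ^ (i : ℕ) * ((x i ⬝ᵥ v) * f (i.removeNth x))) := by
  obtain ⟨F, hF⟩ := hf
  refine ⟨AlternatingMap.alternatizeUncurryFin
    (LinearMap.smulRight ((dotProductBilin ℝ ℝ).flip v) F), fun x => ?_⟩
  rw [AlternatingMap.alternatizeUncurryFin_apply]
  refine Finset.sum_congr rfl fun i _ => ?_
  rw [hF]
  simp

theorem IsAlt.map_perm {n p : ℕ} {f : (Fin p → V n) → ℝ} (hf : IsAlt f) (x : Fin p → V n)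
    (σ : Equiv.Perm (Fin p)) : f (fun i => x (σ i)) = ((Equiv.Perm.sign σ : ℤ) : ℝ) * f x := by
  obtain ⟨F, hF⟩ := hf
  rw [hF, hF, show (fun i => x (σ i)) = x ∘ σ from rfl, F.map_perm]
  simp [Units.smul_def]

theorem IsAlt.map_cons_removeNth {n p : ℕ} {f : (Fin (p + 1) → V n) → ℝ} (hf : IsAlt f)
    (x : Fin (p + 1) → V n) (i : Fin (p + 1)) :
    f (Fin.cons (x i) (i.removeNth x)) = (-1) ^ (i : ℕ) * f x := by
  rw [Fin.cons_removeNth_eq_comp_cycleRange_symm]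
  exact (hf.map_perm x i.cycleRange.symm).trans (by simp [Fin.sign_cycleRange])

theorem IsAlt.sum_cons {n p : ℕ} {f : (Fin (p + 1) → V n) → ℝ} (hf : IsAlt f)
    (v : V n) (x : Fin p → V n) :
    ∑ j, (v ⬝ᵥ E n j) * f (Fin.cons (E n j) x) = f (Fin.cons v x) := by
  obtain ⟨F, hF⟩ := hf
  have hv : v = ∑ j, (v ⬝ᵥ E n j) • E n j := by
    ext k; simp [E, dotProduct, Finset.sum_apply]
  simp only [hF]
  change ∑ j, (v ⬝ᵥ E n j) * F.curryLeft (E n j) x = F.curryLeft v x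
  conv_rhs => rw [hv, map_sum]
  refine Eq.trans ?_ (map_sum (evalAlt x) _ _).symm
  exact Finset.sum_congr rfl fun j _ => by rw [map_smul]; rfl

/-- Separately alternating in both groups of arguments. -/
def IsBialt {n p q : ℕ} (ω : DF n p q) : Prop :=
  (∀ y, IsAlt fun x => ω x y) ∧ ∀ x, IsAlt (ω x)

theorem IsDF.isBialt {n p q : ℕ} {ω : DF n p q} (h : IsDF ω) : IsBialt ω := by
  obtain ⟨F, hF⟩ := h
  refine ⟨fun y => ⟨?_, fun x => ?_⟩, fun x => ⟨F x, hF x⟩⟩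
  · exact (evalAlt y).compAlternatingMap F
  · exact hF x y

/-- Left multiplication by the metric, in expanded form. -/
noncomputable def gmul {n p q : ℕ} (ω : DF n p q) : DF n (p + 1) (q + 1) := fun x y =>
  ∑ i : Fin (p + 1), ∑ j : Fin (q + 1), (-1 : ℝ) ^ (i : ℕ) * (-1 : ℝ) ^ (j : ℕ) *
    ((x i ⬝ᵥ y j) * ω (i.removeNth x) (j.removeNth y))

theorem IsBialt.gmul {n p q : ℕ} {ω : DF n p q} (h : IsBialt ω) : IsBialt (gmul ω) := by
  constructor
  · intro y
    have := IsAlt.sum Finset.univ fun j : Fin (q + 1) =>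
      ((h.1 (j.removeNth y)).wedge (y j)).const_mul ((-1 : ℝ) ^ (j : ℕ))
    convert this using 2 with x
    rw [DoubleForm.gmul, Finset.sum_comm]
    refine Finset.sum_congr rfl fun j _ => ?_
    rw [Finset.mul_sum]
    refine Finset.sum_congr rfl fun i _ => ?_
    ring
  · intro x
    have := IsAlt.sum Finset.univ fun i : Fin (p + 1) =>
      ((h.2 (i.removeNth x)).wedge (x i)).const_mul ((-1 : ℝ) ^ (i : ℕ))
    convert this using 2 with y
    refine Finset.sum_congr rfl fun i _ => ?_
    rw [Finset.mul_sum]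
    refine Finset.sum_congr rfl fun j _ => ?_
    rw [dotProduct_comm]
    ring

theorem IsBialt.contr {n p q : ℕ} {ω : DF n (p + 1) (q + 1)} (h : IsBialt ω) :
    IsBialt (p := p) (q := q) (contr ω) :=
  ⟨fun _ => IsAlt.sum _ fun _ => (h.1 _).cons _, fun _ => IsAlt.sum _ fun _ => (h.2 _).cons _⟩

theorem IsBialt.zero {n p q : ℕ} : IsBialt (0 : DF n p q) :=
  ⟨fun _ => IsAlt.zero, fun _ => IsAlt.zero⟩

theorem removeNth_succ_cons {n p : ℕ} (v : V n) (x : Fin (p + 1) → V n) (i : Fin (p + 1)) :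
    (i.succ).removeNth (Fin.cons v x : Fin (p + 2) → V n) = Fin.cons v (i.removeNth x) := by
  funext j
  refine Fin.cases ?_ (fun j => ?_) j <;> simp [Fin.removeNth]

theorem removeNth_zero_cons {n p : ℕ} (v : V n) (x : Fin p → V n) :
    (0 : Fin (p + 1)).removeNth (Fin.cons v x : Fin (p + 1) → V n) = x := by
  funext j
  simp [Fin.removeNth]

theorem E_dotProduct_E {n : ℕ} (j : Fin n) : E n j ⬝ᵥ E n j = 1 := by
  simp [E, dotProduct]

theorem IsAlt.sum_removeNth_succ_cons {n p : ℕ} {f : (Fin p → V n) → ℝ} (hf : IsAlt f)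
    (x : Fin p → V n) :
    ∑ k, ∑ i : Fin p, (-1 : ℝ) ^ (i.succ : ℕ) *
      ((x i ⬝ᵥ E n k) * f (i.succ.removeNth (Fin.cons (E n k) x : Fin (p + 1) → V n))) =
        -(p * f x) := by
  cases p with
  | zero => simp
  | succ p =>
    rw [Finset.sum_comm]
    have key (i : Fin (p + 1)) : ∑ k, (-1 : ℝ) ^ (i.succ : ℕ) *
        ((x i ⬝ᵥ E n k) * f (i.succ.removeNth (Fin.cons (E n k) x : Fin (p + 2) → V n))) =
          -f x := by
      simp only [removeNth_succ_cons]
      rw [← Finset.mul_sum, (show IsAlt f from hf).sum_cons, hf.map_cons_removeNth, ← mul_assoc,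
        ← pow_add, Odd.neg_one_pow ⟨i, by simp; ring⟩, neg_one_mul]
    rw [Finset.sum_congr rfl fun i _ => key i]
    simp

/-- Contraction after multiplication by the metric: the terms where the metric is contracted
contribute `n - p - q`. -/
theorem contr_gmul {n p q : ℕ} {ω : DF n p q} (h : IsBialt ω) (x : Fin p → V n)
    (y : Fin q → V n) :
    contr (gmul ω) x y = ((n : ℝ) - p - q) * ω x y +
      ∑ k, ∑ i : Fin p, ∑ j : Fin q, (-1 : ℝ) ^ (i : ℕ) * (-1 : ℝ) ^ (j : ℕ) *
        ((x i ⬝ᵥ y j) * ω (i.succ.removeNth (Fin.cons (E n k) x : Fin (p + 1) → V n))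
          (j.succ.removeNth (Fin.cons (E n k) y : Fin (q + 1) → V n))) := by
  have h1 := (h.1 y).sum_removeNth_succ_cons x
  have h2 := (h.2 x).sum_removeNth_succ_cons y
  simp only [contr, gmul, Fin.sum_univ_succ, Fin.cons_zero, Fin.cons_succ, removeNth_zero_cons,
    E_dotProduct_E, Fin.val_zero, pow_zero, one_mul, Finset.sum_add_distrib, mul_one]
  rw [h1]
  simp only [dotProduct_comm (E n _) (y _)]
  rw [h2]
  simp only [Fin.val_succ, pow_succ, mul_neg_one, neg_mul_neg, Finset.sum_const, Finset.card_univ,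
    Fintype.card_fin, nsmul_eq_mul]
  ring

/-- Multiplication by the metric on the total space of double forms. -/
noncomputable def gT (n : ℕ) : DT n →ₗ[ℝ] DT n where
  toFun W
    | p + 1, q + 1 => gmul (W p q)
    | _, _ => 0
  map_add' W W' := by
    funext p q x y
    cases p <;> cases q <;> simp [gmul, mul_add, Finset.sum_add_distrib]
  map_smul' a W := by
    funext p q x y
    cases p <;> cases q <;> simp [gmul, Finset.mul_sum, mul_left_comm]

/-- The contraction on the total space of double forms. -/
noncomputable def cT (n : ℕ) : DT n →ₗ[ℝ] DT n where
  toFun W p q := contr (W (p + 1) (q + 1))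
  map_add' W W' := by
    funext p q x y
    simp [contr, Finset.sum_add_distrib]
  map_smul' a W := by
    funext p q x y
    simp [contr, Finset.mul_sum]

/-- Families of double forms of total degree `d`. -/
def IsHomog {n : ℕ} (d : ℤ) (W : DT n) : Prop :=
  (∀ p q, IsBialt (W p q)) ∧ ∀ p q : ℕ, (p + q : ℤ) ≠ d → W p q = 0

theorem IsHomog.gT {n : ℕ} {d : ℤ} {W : DT n} (h : IsHomog d W) : IsHomog (d + 2) (gT n W) := by
  constructor
  · rintro (_ | p) (_ | q)
    · exact IsBialt.zero
    · exact IsBialt.zero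
    · exact IsBialt.zero
    · exact (h.1 p q).gmul
  · rintro (_ | p) (_ | q) hpq
    · rfl
    · rfl
    · rfl
    · change gmul (W p q) = 0
      rw [h.2 p q (by push_cast at hpq; omega)]
      funext x y
      simp [gmul]

theorem IsHomog.cT {n : ℕ} {d : ℤ} {W : DT n} (h : IsHomog d W) : IsHomog (d - 2) (cT n W) := by
  refine ⟨fun p q => (h.1 (p + 1) (q + 1)).contr, fun p q hpq => ?_⟩
  change contr (W (p + 1) (q + 1)) = 0
  rw [h.2 (p + 1) (q + 1) (by push_cast; omega)]
  funext x y
  simp [contr]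

theorem IsHomog.eq_zero_of_neg {n : ℕ} {d : ℤ} {W : DT n} (h : IsHomog d W) (hd : d < 0) :
    W = 0 := by
  funext p q
  exact h.2 p q (by omega)

theorem IsHomog.cT_gT {n : ℕ} {d : ℤ} {W : DT n} (h : IsHomog d W) :
    DoubleForm.cT n (DoubleForm.gT n W) =
      DoubleForm.gT n (DoubleForm.cT n W) + ((n : ℝ) - d) • W := by
  funext p q x y
  have hd : ((n : ℝ) - p - q) * W p q x y = ((n : ℝ) - d) * W p q x y := by
    by_cases hpq : (p + q : ℤ) = d
    · rw [← hpq]; push_cast; ring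
    · simp [h.2 p q hpq]
  refine (contr_gmul (h.1 p q) x y).trans ?_
  rw [hd, add_comm]
  change _ = DoubleForm.gT n (DoubleForm.cT n W) p q x y + ((n : ℝ) - d) * W p q x y
  congr 1
  rcases p with _ | p
  · simp [DoubleForm.gT]
  rcases q with _ | q
  · simp [DoubleForm.gT]
  simp only [removeNth_succ_cons]
  change _ = gmul (contr (W (p + 1) (q + 1))) x y
  simp only [gmul, contr, Finset.mul_sum]
  rw [Finset.sum_comm]
  exact Finset.sum_congr rfl fun i _ => Finset.sum_comm

/-- The representation-theoretic core: `L` raises and `c` lowers the degree by two, and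
`[c, L] = n - d` in degree `d`. -/
theorem pow_apply_eq_zero_of_bracket {M : Type*} [AddCommGroup M] [Module ℝ M]
    (L c : M →ₗ[ℝ] M) (P : ℤ → M → Prop) (n : ℕ)
    (hL : ∀ d w, P d w → P (d + 2) (L w)) (hc : ∀ d w, P d w → P (d - 2) (c w))
    (hneg : ∀ d w, P d w → d < 0 → w = 0)
    (hbr : ∀ d w, P d w → c (L w) = L (c w) + ((n : ℝ) - d) • w)
    (k l : ℕ) (d : ℤ) (w : M) (hw : P d w) (hd : l + d ≤ n + k) (h0 : (L ^ l) w = 0) :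
    (c ^ k) w = 0 := by
  have hcL (l : ℕ) : ∀ d w, P d w → c ((L ^ (l + 1)) w) =
      (L ^ (l + 1)) (c w) + ((l + 1 : ℝ) * (n - d - l)) • (L ^ l) w := by
    induction l with
    | zero => intro d w hw; simpa using hbr d w hw
    | succ l ih =>
      intro d w hw
      rw [pow_succ L (l + 1), Module.End.mul_apply, ih _ _ (hL d w hw), hbr d w hw, map_add,
        map_smul, Module.End.mul_apply, ← Module.End.mul_apply (L ^ l), ← pow_succ, add_assoc,
        ← add_smul]
      congr 2
      push_cast
      ring
  have hstep (l : ℕ) (d : ℤ) (w : M) (hw : P d w) (h0 : (L ^ l) w = 0) :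
      (L ^ (l + 1)) (c w) = 0 := by
    cases l with
    | zero =>
      have hw0 : w = 0 := h0
      simp [hw0]
    | succ l =>
      have h1 := hcL l d w hw
      rw [h0, map_zero] at h1
      have h2 := congrArg L h1
      rw [map_add, map_zero, map_smul, ← Module.End.mul_apply, ← Module.End.mul_apply L (L ^ l),
        ← pow_succ', ← pow_succ', h0, smul_zero, add_zero] at h2
      exact h2.symm
  have hinj (m : ℕ) : ∀ (d : ℤ) (l : ℕ) (w : M), d < m → P d w → l + d ≤ n →
      (L ^ l) w = 0 → w = 0 := by
    induction m using Nat.strong_induction_on with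
    | _ m ihm =>
    intro d l w hdm hw hd h0
    by_cases hd0 : d < 0
    · exact hneg d w hw hd0
    have hcw : c w = 0 :=
      ihm (m - 1) (by omega) (d - 2) (l + 1) (c w) (by omega) (hc d w hw)
        (by push_cast; omega) (hstep l d w hw h0)
    induction l with
    | zero => exact h0
    | succ l ihl =>
      refine ihl (by push_cast at hd; omega) ?_
      have h1 := hcL l d w hw
      rw [h0, hcw, map_zero, map_zero, zero_add] at h1
      refine (smul_eq_zero.1 h1.symm).resolve_left (mul_ne_zero (by positivity) ?_)
      have : ((l : ℝ) + 1 + d) ≤ n := by exact_mod_cast hd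
      linarith
  induction k generalizing l d w with
  | zero => exact hinj (d.toNat + 1) d l w (by omega) hw (by simpa using hd) h0
  | succ k ih =>
    rw [pow_succ, Module.End.mul_apply]
    exact ih (l + 1) (d - 2) (c w) (hc d w hw) (by push_cast at hd ⊢; omega) (hstep l d w hw h0)

/-- Antisymmetrization in both groups of arguments, without normalization. -/
noncomputable def altSum {n p q : ℕ} (T : DF n p q) : DF n p q := fun x y =>
  ∑ σ : Equiv.Perm (Fin p), ∑ ρ : Equiv.Perm (Fin q),
    ((Equiv.Perm.sign σ : ℤ) : ℝ) * ((Equiv.Perm.sign ρ : ℤ) : ℝ) *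
      T (fun i => x (σ i)) (fun j => y (ρ j))

/-- The tensor product of double forms. -/
def tens {n p q r s : ℕ} (T : DF n p q) (U : DF n r s) : DF n (p + r) (q + s) := fun x y =>
  T (fun i => x (Fin.castAdd r i)) (fun j => y (Fin.castAdd s j)) *
    U (fun i => x (Fin.natAdd p i)) (fun j => y (Fin.natAdd q j))

/-- Precomposition with permutations of the arguments. -/
def permDF {n p q : ℕ} (τ : Equiv.Perm (Fin p)) (τ' : Equiv.Perm (Fin q)) (T : DF n p q) :
    DF n p q := fun x y => T (fun i => x (τ i)) (fun j => y (τ' j))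

theorem altSum_smul {n p q : ℕ} (a : ℝ) (T : DF n p q) : altSum (a • T) = a • altSum T := by
  funext x y
  simp [altSum, Finset.mul_sum, mul_left_comm]

theorem altSum_sum {n p q : ℕ} {ι : Type*} (s : Finset ι) (T : ι → DF n p q) :
    altSum (∑ i ∈ s, T i) = ∑ i ∈ s, altSum (T i) := by
  funext x y
  simp only [altSum, Finset.sum_apply, Finset.mul_sum]
  conv_rhs => rw [Finset.sum_comm]
  refine Finset.sum_congr rfl fun σ _ => ?_
  rw [Finset.sum_comm]

theorem tens_smul_left {n p q r s : ℕ} (a : ℝ) (T : DF n p q) (U : DF n r s) :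
    tens (a • T) U = a • tens T U := by
  funext x y
  simp [tens, mul_assoc]

theorem tens_smul_right {n p q r s : ℕ} (a : ℝ) (T : DF n p q) (U : DF n r s) :
    tens T (a • U) = a • tens T U := by
  funext x y
  simp [tens, mul_left_comm]

theorem tens_sum_left {n p q r s : ℕ} {ι : Type*} (t : Finset ι) (T : ι → DF n p q)
    (U : DF n r s) : tens (∑ i ∈ t, T i) U = ∑ i ∈ t, tens (T i) U := by
  funext x y
  simp [tens, Finset.sum_apply, Finset.sum_mul]

theorem tens_sum_right {n p q r s : ℕ} {ι : Type*} (t : Finset ι) (T : DF n p q)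
    (U : ι → DF n r s) : tens T (∑ i ∈ t, U i) = ∑ i ∈ t, tens T (U i) := by
  funext x y
  simp [tens, Finset.sum_apply, Finset.mul_sum]

theorem altSum_eq_sum {n p q : ℕ} (T : DF n p q) :
    altSum T = ∑ σ : Equiv.Perm (Fin p), ∑ ρ : Equiv.Perm (Fin q),
      (((Equiv.Perm.sign σ : ℤ) : ℝ) * ((Equiv.Perm.sign ρ : ℤ) : ℝ)) • permDF σ ρ T := by
  funext x y
  simp [altSum, permDF, Finset.sum_apply]

theorem sign_mul_self {p : ℕ} (σ : Equiv.Perm (Fin p)) :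
    ((Equiv.Perm.sign σ : ℤ) : ℝ) * ((Equiv.Perm.sign σ : ℤ) : ℝ) = 1 := by
  rcases Int.units_eq_one_or (Equiv.Perm.sign σ) with h | h <;> simp [h]

theorem altSum_permDF {n p q : ℕ} (τ : Equiv.Perm (Fin p)) (τ' : Equiv.Perm (Fin q))
    (T : DF n p q) :
    altSum (permDF τ τ' T) =
      (((Equiv.Perm.sign τ : ℤ) : ℝ) * ((Equiv.Perm.sign τ' : ℤ) : ℝ)) • altSum T := by
  funext x y
  simp only [altSum, Pi.smul_apply, smul_eq_mul, Finset.mul_sum]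
  refine Eq.trans ?_ (Equiv.sum_comp (Equiv.mulRight τ) _)
  refine Finset.sum_congr rfl fun σ _ => ?_
  refine Eq.trans ?_ (Equiv.sum_comp (Equiv.mulRight τ') _)
  refine Finset.sum_congr rfl fun ρ _ => ?_
  simp only [permDF, Equiv.coe_mulRight, Equiv.Perm.sign_mul, Units.val_mul, Int.cast_mul,
    Equiv.Perm.mul_apply]
  linear_combination (-((Equiv.Perm.sign σ : ℤ) : ℝ) * ((Equiv.Perm.sign ρ : ℤ) : ℝ) *
    T (fun i => x (σ (τ i))) fun j => y (ρ (τ' j))) *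
    (sign_mul_self τ + ((Equiv.Perm.sign τ : ℤ) : ℝ) ^ 2 * sign_mul_self τ')

theorem altSum_reindex {n p q p' q' : ℕ} (e : Fin p ≃ Fin p') (e' : Fin q ≃ Fin q')
    (T : DF n p q) (x : Fin p' → V n) (y : Fin q' → V n) :
    altSum (fun (x : Fin p' → V n) (y : Fin q' → V n) => T (fun i => x (e i)) fun j => y (e' j))
      x y = altSum T (fun i => x (e i)) (fun j => y (e' j)) := by
  simp only [altSum]
  rw [← Equiv.sum_comp e.permCongr]
  refine Finset.sum_congr rfl fun σ _ => ?_
  rw [← Equiv.sum_comp e'.permCongr]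
  refine Finset.sum_congr rfl fun ρ _ => ?_
  simp

/-- The permutation acting by `τ` on the first `p` letters. -/
def permLeft {p : ℕ} (r : ℕ) (τ : Equiv.Perm (Fin p)) : Equiv.Perm (Fin (p + r)) :=
  finSumFinEquiv.permCongr (Equiv.Perm.sumCongr τ 1)

/-- The permutation acting by `τ` on the last `r` letters. -/
def permRight (p : ℕ) {r : ℕ} (τ : Equiv.Perm (Fin r)) : Equiv.Perm (Fin (p + r)) :=
  finSumFinEquiv.permCongr (Equiv.Perm.sumCongr 1 τ)

theorem tens_permDF_left {n p q r s : ℕ} (τ : Equiv.Perm (Fin p)) (τ' : Equiv.Perm (Fin q))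
    (T : DF n p q) (U : DF n r s) :
    tens (permDF τ τ' T) U = permDF (permLeft r τ) (permLeft s τ') (tens T U) := by
  funext x y
  simp [tens, permDF, permLeft]

theorem tens_permDF_right {n p q r s : ℕ} (τ : Equiv.Perm (Fin r)) (τ' : Equiv.Perm (Fin s))
    (T : DF n p q) (U : DF n r s) :
    tens T (permDF τ τ' U) = permDF (permRight p τ) (permRight q τ') (tens T U) := by
  funext x y
  simp [tens, permDF, permRight]

theorem altSum_tens_permDF_left {n p q r s : ℕ} (τ : Equiv.Perm (Fin p))
    (τ' : Equiv.Perm (Fin q)) (T : DF n p q) (U : DF n r s) :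
    altSum (tens (permDF τ τ' T) U) =
      (((Equiv.Perm.sign τ : ℤ) : ℝ) * ((Equiv.Perm.sign τ' : ℤ) : ℝ)) • altSum (tens T U) := by
  rw [tens_permDF_left, altSum_permDF]
  simp [permLeft]

theorem altSum_tens_permDF_right {n p q r s : ℕ} (τ : Equiv.Perm (Fin r))
    (τ' : Equiv.Perm (Fin s)) (T : DF n p q) (U : DF n r s) :
    altSum (tens T (permDF τ τ' U)) =
      (((Equiv.Perm.sign τ : ℤ) : ℝ) * ((Equiv.Perm.sign τ' : ℤ) : ℝ)) • altSum (tens T U) := by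
  rw [tens_permDF_right, altSum_permDF]
  simp [permRight]

theorem altSum_tens_altSum {n p q r s : ℕ} (T : DF n p q) (U : DF n r s) :
    altSum (tens (altSum T) U) = ((p.factorial : ℝ) * q.factorial) • altSum (tens T U) := by
  rw [altSum_eq_sum T]
  simp only [tens_sum_left, altSum_sum, tens_smul_left, altSum_smul, altSum_tens_permDF_left,
    smul_smul]
  have (σ : Equiv.Perm (Fin p)) (ρ : Equiv.Perm (Fin q)) :
      ((Equiv.Perm.sign σ : ℤ) : ℝ) * ((Equiv.Perm.sign ρ : ℤ) : ℝ) *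
        (((Equiv.Perm.sign σ : ℤ) : ℝ) * ((Equiv.Perm.sign ρ : ℤ) : ℝ)) = 1 := by
    rw [mul_mul_mul_comm, sign_mul_self, sign_mul_self, one_mul]
  simp only [this, one_smul, Finset.sum_const, Finset.card_univ, Fintype.card_perm,
    Fintype.card_fin, smul_smul, ← Nat.cast_smul_eq_nsmul ℝ]

theorem mul_eq_smul_altSum {n p q r s : ℕ} (T : DF n p q) (U : DF n r s) :
    mul T U = (((p.factorial * r.factorial * q.factorial * s.factorial : ℕ) : ℝ))⁻¹ •
      altSum (tens T U) := by
  funext x y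
  simp only [mul, altSum, tens, Pi.smul_apply, smul_eq_mul, mul_assoc]

/-- The `l`-fold tensor power of the metric. -/
noncomputable def tensPow (n l : ℕ) : DF n l l := fun x y => ∏ i, x i ⬝ᵥ y i

theorem tensPow_succ (n l : ℕ) : tensPow n (l + 1) = tens (tensPow n l) (gm n) := by
  funext x y
  exact Fin.prod_univ_castSucc _

theorem gpow_eq_smul_altSum (n l : ℕ) :
    ∃ a : ℝ, a ≠ 0 ∧ gpow n l = a • altSum (tensPow n l) := by
  induction l with
  | zero =>
    refine ⟨1, one_ne_zero, ?_⟩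
    funext x y
    simp [gpow, altSum, tensPow]
  | succ l ih =>
    obtain ⟨a, ha, h⟩ := ih
    rw [gpow, h, mul_eq_smul_altSum, tens_smul_left, altSum_smul, altSum_tens_altSum,
      ← tensPow_succ, smul_smul, smul_smul]
    exact ⟨_, by positivity, rfl⟩

theorem altSum_tens_tensPow_eq_zero {n p q l : ℕ} {ω : DF n p q} (h : mul (gpow n l) ω = 0) :
    altSum (tens (tensPow n l) ω) = 0 := by
  obtain ⟨a, ha, h'⟩ := gpow_eq_smul_altSum n l
  rw [h', mul_eq_smul_altSum, tens_smul_left, altSum_smul, altSum_tens_altSum, smul_smul,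
    smul_smul] at h
  exact (smul_eq_zero.1 h).resolve_left (by positivity)

theorem gmul_eq_sum_permDF {n p q : ℕ} (ω : DF n p q) :
    gmul ω = ∑ i : Fin (p + 1), ∑ j : Fin (q + 1),
      ((-1 : ℝ) ^ (i : ℕ) * (-1 : ℝ) ^ (j : ℕ)) • permDF i.cycleRange.symm j.cycleRange.symm
        (fun x y => (x 0 ⬝ᵥ y 0) * ω (Fin.tail x) (Fin.tail y)) := by
  funext x y
  simp only [gmul, permDF, Finset.sum_apply, Pi.smul_apply, smul_eq_mul, Fin.cycleRange_symm_zero,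
    Fin.tail_def, Fin.cycleRange_symm_succ]
  rfl

theorem altSum_tens_gmul {n p q r s : ℕ} (T : DF n r s) (ω : DF n p q) :
    altSum (tens T (gmul ω)) = ((p + 1 : ℝ) * (q + 1)) •
      altSum (tens T (fun x y => (x 0 ⬝ᵥ y 0) * ω (Fin.tail x) (Fin.tail y) :
        DF n (p + 1) (q + 1))) := by
  rw [gmul_eq_sum_permDF]
  simp only [tens_sum_right, altSum_sum, tens_smul_right, altSum_smul, altSum_tens_permDF_right,
    smul_smul, Equiv.Perm.sign_symm, Fin.sign_cycleRange]
  have (i j : ℕ) : (-1 : ℝ) ^ i * (-1 : ℝ) ^ j *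
      ((((-1 : ℤˣ) ^ i : ℤˣ) : ℤ) * (((-1 : ℤˣ) ^ j : ℤˣ) : ℤ)) = 1 := by
    push_cast
    rw [mul_mul_mul_comm, ← mul_pow, ← mul_pow]
    norm_num
  simp only [this, one_smul, Finset.sum_const, Finset.card_univ, Fintype.card_fin, smul_smul,
    ← Nat.cast_smul_eq_nsmul ℝ]
  push_cast
  rfl

theorem altSum_tens_gmul_eq_zero {n p q l : ℕ} {ω : DF n p q}
    (h : altSum (tens (tensPow n (l + 1)) ω) = 0) :
    altSum (tens (tensPow n l) (gmul ω)) = 0 := by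
  rw [altSum_tens_gmul]
  refine smul_eq_zero_of_right _ ?_
  funext x y
  have := altSum_reindex (finCongr (by omega : l + 1 + p = l + (p + 1)))
    (finCongr (by omega : l + 1 + q = l + (q + 1))) (tens (tensPow n (l + 1)) ω) x y
  rw [h] at this
  refine Eq.trans ?_ this
  congr 1
  funext x y
  simp only [tensPow_succ]
  simp only [tens, gm, mul_assoc]
  congr 1
  have hx (r : ℕ) (h : l + 1 + r = l + (r + 1)) (i : Fin r) :
      finCongr h (Fin.natAdd (l + 1) i) = Fin.natAdd l i.succ := by
    ext
    simp
    omega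
  simp only [hx]
  rfl

theorem IsBialt.eq_zero_of_altSum {n p q : ℕ} {ω : DF n p q} (hω : IsBialt ω)
    (h : altSum (tens (tensPow n 0) ω) = 0) : ω = 0 := by
  have h1 : altSum ω = ((p.factorial : ℝ) * q.factorial) • ω := by
    funext x y
    have (σ : Equiv.Perm (Fin p)) (ρ : Equiv.Perm (Fin q)) :
        ((Equiv.Perm.sign σ : ℤ) : ℝ) * ((Equiv.Perm.sign ρ : ℤ) : ℝ) *
          ω (fun i => x (σ i)) (fun j => y (ρ j)) = ω x y := by
      rw [(hω.2 _).map_perm y ρ, (hω.1 y).map_perm x σ]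
      linear_combination ω x y * (sign_mul_self σ +
        ((Equiv.Perm.sign σ : ℤ) : ℝ) ^ 2 * sign_mul_self ρ)
    simp [altSum, this, Fintype.card_perm, mul_assoc]
  have h2 : altSum ω = 0 := by
    funext x y
    have := altSum_reindex (finCongr (zero_add p)) (finCongr (zero_add q))
      (tens (tensPow n 0) ω) x y
    rw [h] at this
    refine Eq.trans ?_ this
    congr 1
    funext x y
    simp only [tens, tensPow, Finset.univ_eq_empty, Finset.prod_empty, one_mul]
    have hx (r : ℕ) (i : Fin r) : finCongr (zero_add r) (Fin.natAdd 0 i) = i := by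
      ext
      simp
    simp only [hx]
  rw [h1] at h2
  exact (smul_eq_zero.1 h2).resolve_left (by positivity)

theorem emb_apply_self {n p q : ℕ} (ω : DF n p q) : emb p q ω p q = ω := by
  simp [emb]
  rfl

theorem gT_emb {n p q : ℕ} (ω : DF n p q) : gT n (emb p q ω) = emb (p + 1) (q + 1) (gmul ω) := by
  funext p' q'
  rcases p' with _ | p'
  · simp [gT, emb]
  rcases q' with _ | q'
  · simp [gT, emb]
  change gmul (emb p q ω p' q') = _
  by_cases h : p = p' ∧ q = q'
  · obtain ⟨rfl, rfl⟩ := h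
    rw [emb_apply_self, emb_apply_self]
  · simp only [emb, add_left_inj, dif_neg h]
    funext x y
    simp [gmul]

theorem IsBialt.isHomog_emb {n p q : ℕ} {ω : DF n p q} (h : IsBialt ω) :
    IsHomog (p + q) (emb p q ω) := by
  constructor
  · intro p' q'
    by_cases h' : p = p' ∧ q = q'
    · obtain ⟨rfl, rfl⟩ := h'
      rwa [emb_apply_self]
    · rw [emb, dif_neg h']
      exact IsBialt.zero
  · intro p' q' hd
    rw [emb, dif_neg]
    omega

theorem gT_pow_emb_eq_zero {n l p q : ℕ} {ω : DF n p q} (hω : IsBialt ω)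
    (h : altSum (tens (tensPow n l) ω) = 0) : (gT n ^ l) (emb p q ω) = 0 := by
  induction l generalizing p q with
  | zero =>
    rw [hω.eq_zero_of_altSum h]
    funext p' q'
    by_cases h' : p = p' ∧ q = q'
    · obtain ⟨rfl, rfl⟩ := h'
      exact emb_apply_self _
    · rw [pow_zero, Module.End.one_apply, emb, dif_neg h']
      rfl
  | succ l ih =>
    rw [pow_succ, Module.End.mul_apply, gT_emb]
    exact ih hω.gmul (altSum_tens_gmul_eq_zero h)

theorem contr_eq_cT {n p q : ℕ} (hp : p ≠ 0) (hq : q ≠ 0) (W : DT n) :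
    contr (W p q) = cT n W (p - 1) (q - 1) := by
  obtain ⟨p, rfl⟩ := Nat.exists_eq_succ_of_ne_zero hp
  obtain ⟨q, rfl⟩ := Nat.exists_eq_succ_of_ne_zero hq
  rfl

theorem contr_eq_zero {n p q : ℕ} (h : p = 0 ∨ q = 0) (ω : DF n p q) : contr ω = 0 := by
  rcases p with _ | p <;> rcases q with _ | q <;> first | rfl | omega

theorem ck_eq_cT_pow {n p q k : ℕ} (hp : k ≤ p) (hq : k ≤ q) (W : DT n) :
    ck k (W p q) = (cT n ^ k) W (p - k) (q - k) := by
  induction k with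
  | zero => rfl
  | succ k ih =>
    rw [ck, ih (by omega) (by omega), pow_succ', Module.End.mul_apply]
    exact contr_eq_cT (p := p - k) (q := q - k) (by omega) (by omega) _

theorem ck_eq_zero_of_lt {n p q k : ℕ} (h : p < k ∨ q < k) (ω : DF n p q) : ck k ω = 0 := by
  cases k with
  | zero => omega
  | succ k => exact contr_eq_zero (p := p - k) (q := q - k) (by omega) _

/-- if `g^l ω = 0` and `l + p + q < n + 1 + k`, then `c^k ω = 0`. -/
theorem ck_eq_zero_of_gpow_mul_eq_zero (n p q l k : ℕ) (h : l + p + q < n + 1 + k)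
    (ω : DF n p q) (hω : IsDF ω) (h0 : mul (gpow n l) ω = 0) : ck k ω = 0 := by
  by_cases hk : p < k ∨ q < k
  · exact ck_eq_zero_of_lt hk ω
  have hg := gT_pow_emb_eq_zero hω.isBialt (altSum_tens_tensPow_eq_zero h0)
  have hc := pow_apply_eq_zero_of_bracket (gT n) (cT n) IsHomog n (fun _ _ => IsHomog.gT)
    (fun _ _ => IsHomog.cT) (fun _ _ => IsHomog.eq_zero_of_neg) (fun _ _ => IsHomog.cT_gT)
    k l (p + q) _ hω.isBialt.isHomog_emb (by omega) hg
  rw [← emb_apply_self ω, ck_eq_cT_pow (by omega) (by omega), hc]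
  rfl

end DoubleForm
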